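/- arXiv:0803.2392 — 2 statements merged into one kernel-verified Lean document; each statement's English description precedes it below -/
import Mathlib

section
/- Suppose the m×N complex matrix Φ has restricted isometry constant δ_r = δ_r(Φ). Let S and T be disjoint sets of indices with |S| + |T| ≤ r. Then the spectral norm of Φ_S*Φ_T satisfies ‖Φ_S*Φ_T‖ ≤ δ_r. -/
open Matrix
open scoped BigOperators Classical

/-- The Euclidean (ℓ₂) norm of a finitely indexed complex vector. -/
noncomputable def l2 {ι : Type*} [Fintype ι] (x : ι → ℂ) : ℝ :=
  Real.sqrt (∑ i, ‖x i‖ ^ 2)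

/-- The ℓ₁ norm of a finitely indexed complex vector. -/
noncomputable def l1 {ι : Type*} [Fintype ι] (x : ι → ℂ) : ℝ := ∑ i, ‖x i‖

/-- The ℓ∞ (supremum) norm of a finitely indexed complex vector. -/
noncomputable def linf {ι : Type*} [Fintype ι] (x : ι → ℂ) : ℝ := ⨆ i, ‖x i‖

/-- The support of a vector, as a finite set of coordinates. -/
noncomputable def suppF {N : ℕ} (x : Fin N → ℂ) : Finset (Fin N) :=
  Finset.univ.filter fun i => x i ≠ 0

/-- A vector is `s`-sparse when it has at most `s` nonzero entries. -/
def Sparse {N : ℕ} (s : ℕ) (x : Fin N → ℂ) : Prop := (suppF x).card ≤ s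

/-- Restriction of a vector to a set `T` of coordinates: equal to `x` on `T`, zero off `T`. -/
noncomputable def restrictTo {N : ℕ} (x : Fin N → ℂ) (T : Finset (Fin N)) : Fin N → ℂ :=
  fun i => if i ∈ T then x i else 0

/-- `y` is a best `s`-sparse approximation of `x`: it agrees with `x` on a set of `s`
coordinates of largest magnitude and vanishes elsewhere. -/
def IsSparseApprox {N : ℕ} (s : ℕ) (x y : Fin N → ℂ) : Prop :=
  ∃ T : Finset (Fin N), T.card = min s N ∧ y = restrictTo x T ∧
    ∀ i ∈ T, ∀ j ∉ T, ‖x j‖ ≤ ‖x i‖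

/-- The `r`-th restricted isometry constant of `Φ`: the least `δ ≥ 0` such that
`(1-δ)‖x‖² ≤ ‖Φx‖² ≤ (1+δ)‖x‖²` for all `r`-sparse `x`. -/
noncomputable def RIC {m N : ℕ} (Φ : Matrix (Fin m) (Fin N) ℂ) (r : ℕ) : ℝ :=
  sInf {δ : ℝ | 0 ≤ δ ∧ ∀ x : Fin N → ℂ, Sparse r x →
    (1 - δ) * l2 x ^ 2 ≤ l2 (Φ.mulVec x) ^ 2 ∧ l2 (Φ.mulVec x) ^ 2 ≤ (1 + δ) * l2 x ^ 2}

/-- The column submatrix of `Φ` with columns indexed by the finite set `T`. -/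
noncomputable def colSub {m N : ℕ} (Φ : Matrix (Fin m) (Fin N) ℂ) (T : Finset (Fin N)) :
    Matrix (Fin m) {i // i ∈ T} ℂ :=
  Matrix.of fun r c => Φ r c.1

/-- The least-squares estimate `Φ_T† u = (Φ_T* Φ_T)⁻¹ Φ_T* u`, viewed as a vector in `ℂ^N`
supported on `T`. -/
noncomputable def pinvApply {m N : ℕ} (Φ : Matrix (Fin m) (Fin N) ℂ) (T : Finset (Fin N))
    (u : Fin m → ℂ) : Fin N → ℂ :=
  fun j =>
    if h : j ∈ T then (((colSub Φ T)ᴴ * colSub Φ T)⁻¹ * (colSub Φ T)ᴴ).mulVec u ⟨j, h⟩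
    else 0

/-- One iteration of CoSaMP with samples `u` and sparsity level `s`, mapping the current
approximation `a` to the next approximation `a'`. -/
def CoSaMPStep {m N : ℕ} (Φ : Matrix (Fin m) (Fin N) ℂ) (u : Fin m → ℂ) (s : ℕ)
    (a a' : Fin N → ℂ) : Prop :=
  ∃ y2s : Fin N → ℂ,
    IsSparseApprox (2 * s) (Φᴴ.mulVec (u - Φ.mulVec a)) y2s ∧
    IsSparseApprox s (pinvApply Φ (suppF y2s ∪ suppF a) u) a'

/-- `a` is a sequence of approximations produced by CoSaMP: `a 0 = 0` and each successive
approximation arises from one CoSaMP iteration. -/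
def CoSaMPSeq {m N : ℕ} (Φ : Matrix (Fin m) (Fin N) ℂ) (u : Fin m → ℂ) (s : ℕ)
    (a : ℕ → Fin N → ℂ) : Prop :=
  a 0 = 0 ∧ ∀ k, CoSaMPStep Φ u s (a k) (a (k + 1))

/-- The spectral norm (ℓ₂ → ℓ₂ operator norm) of a matrix. -/
noncomputable def specNorm {a b : Type*} [Fintype a] [Fintype b] (M : Matrix a b ℂ) : ℝ :=
  sSup ((fun x => l2 (M.mulVec x)) '' {x | l2 x ≤ 1})

theorem l2_sq {ι : Type*} [Fintype ι] (x : ι → ℂ) : l2 x ^ 2 = ∑ i, ‖x i‖ ^ 2 :=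
  Real.sq_sqrt (Finset.sum_nonneg fun _ _ => sq_nonneg _)

theorem l2_nonneg {ι : Type*} [Fintype ι] (x : ι → ℂ) : 0 ≤ l2 x := Real.sqrt_nonneg _

/-- The spectral norm is bounded by the Frobenius norm. -/
theorem l2_mulVec_sq_le {m N : ℕ} (Φ : Matrix (Fin m) (Fin N) ℂ) (x : Fin N → ℂ) :
    l2 (Φ.mulVec x) ^ 2 ≤ (∑ i, ∑ j, ‖Φ i j‖ ^ 2) * l2 x ^ 2 := by
  rw [l2_sq, l2_sq, Finset.sum_mul]
  refine Finset.sum_le_sum fun i _ => ?_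
  have h : ‖Φ.mulVec x i‖ ≤ ∑ j, ‖Φ i j‖ * ‖x j‖ := by
    simpa only [Matrix.mulVec, dotProduct, norm_mul] using norm_sum_le Finset.univ fun j => Φ i j * x j
  exact (pow_le_pow_left₀ (norm_nonneg _) h 2).trans (Finset.sum_mul_sq_le_sq_mul_sq _ _ _)

/-- Extension by zero of a vector indexed by `S`. -/
noncomputable def extendZero {N : ℕ} (S : Finset (Fin N)) (v : {i // i ∈ S} → ℂ) :
    Fin N → ℂ :=
  fun i => if h : i ∈ S then v ⟨i, h⟩ else 0

theorem extendZero_of_notMem {N : ℕ} {S : Finset (Fin N)} (v : {i // i ∈ S} → ℂ) {i : Fin N}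
    (h : i ∉ S) : extendZero S v i = 0 := dif_neg h

theorem extendZero_coe {N : ℕ} {S : Finset (Fin N)} (v : {i // i ∈ S} → ℂ)
    (i : {i // i ∈ S}) : extendZero S v i = v i := dif_pos i.2

theorem l2_extendZero_sq {N : ℕ} (S : Finset (Fin N)) (v : {i // i ∈ S} → ℂ) :
    l2 (extendZero S v) ^ 2 = l2 v ^ 2 := by
  rw [l2_sq, l2_sq, ← Finset.sum_subset (Finset.subset_univ S)
    (fun i _ hi => by simp [extendZero_of_notMem v hi]), ← Finset.sum_coe_sort S]
  simp only [extendZero_coe]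

theorem mulVec_extendZero {m N : ℕ} (Φ : Matrix (Fin m) (Fin N) ℂ) (S : Finset (Fin N))
    (v : {i // i ∈ S} → ℂ) : Φ.mulVec (extendZero S v) = (colSub Φ S).mulVec v := by
  funext k
  simp only [Matrix.mulVec, dotProduct]
  rw [← Finset.sum_subset (Finset.subset_univ S)
    (fun i _ hi => by simp [extendZero_of_notMem v hi]), ← Finset.sum_coe_sort S]
  simp only [extendZero_coe, colSub, Matrix.of_apply]

theorem sparse_extendZero_add {N r : ℕ} {S T : Finset (Fin N)} (hcard : S.card + T.card ≤ r)
    (u : {i // i ∈ S} → ℂ) (v : {i // i ∈ T} → ℂ) (c : ℂ) :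
    Sparse r (extendZero S u + c • extendZero T v) := by
  refine (Finset.card_le_card (t := S ∪ T) fun i hi => ?_).trans
    ((Finset.card_union_le S T).trans hcard)
  by_contra h
  rw [Finset.mem_union, not_or] at h
  simp [suppF, extendZero_of_notMem u h.1, extendZero_of_notMem v h.2] at hi

theorem l2_extendZero_add_sq {N : ℕ} {S T : Finset (Fin N)} (hdisj : Disjoint S T)
    (u : {i // i ∈ S} → ℂ) (v : {i // i ∈ T} → ℂ) (c : ℂ) :
    l2 (extendZero S u + c • extendZero T v) ^ 2 = l2 u ^ 2 + ‖c‖ ^ 2 * l2 v ^ 2 := by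
  rw [← l2_extendZero_sq S, ← l2_extendZero_sq T, l2_sq, l2_sq, l2_sq, Finset.mul_sum,
    ← Finset.sum_add_distrib]
  refine Finset.sum_congr rfl fun i _ => ?_
  by_cases h : i ∈ S
  · simp [extendZero_of_notMem v (Finset.disjoint_left.mp hdisj h)]
  · simp [extendZero_of_notMem u h, mul_pow]

theorem l2_add_sq_sub_l2_sub_sq {ι : Type*} [Fintype ι] (p q : ι → ℂ) (t : ℝ) :
    l2 (p + (t : ℂ) • q) ^ 2 - l2 (p + ((-t : ℝ) : ℂ) • q) ^ 2
      = 4 * t * (star p ⬝ᵥ q).re := by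
  rw [l2_sq, l2_sq, ← Finset.sum_sub_distrib, dotProduct, Complex.re_sum, Finset.mul_sum]
  refine Finset.sum_congr rfl fun i _ => ?_
  simp only [Complex.sq_norm, Complex.normSq_apply, Pi.add_apply, Pi.smul_apply, smul_eq_mul,
    Pi.star_apply, RCLike.star_def, Complex.add_re, Complex.add_im, Complex.mul_re,
    Complex.mul_im, Complex.ofReal_re, Complex.ofReal_im, Complex.conj_re, Complex.conj_im]
  ring

theorem star_dotProduct_self_re {ι : Type*} [Fintype ι] (u : ι → ℂ) :
    (star u ⬝ᵥ u).re = l2 u ^ 2 := by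
  rw [l2_sq, dotProduct, Complex.re_sum]
  refine Finset.sum_congr rfl fun i _ => ?_
  simp [Complex.sq_norm, Complex.normSq_apply]

/-- **Approximate orthogonality.**  If `S` and `T` are disjoint index sets with
`|S| + |T| ≤ r`, then the spectral norm of `Φ_S* Φ_T` is at most `δ_r(Φ)`. -/
theorem approximate_orthogonality
    {m N : ℕ} (r : ℕ) (Φ : Matrix (Fin m) (Fin N) ℂ)
    (S T : Finset (Fin N)) (hdisj : Disjoint S T) (hcard : S.card + T.card ≤ r) :
    specNorm ((colSub Φ S)ᴴ * colSub Φ T) ≤ RIC Φ r := by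
  have hne : {δ : ℝ | 0 ≤ δ ∧ ∀ x : Fin N → ℂ, Sparse r x →
      (1 - δ) * l2 x ^ 2 ≤ l2 (Φ.mulVec x) ^ 2 ∧
        l2 (Φ.mulVec x) ^ 2 ≤ (1 + δ) * l2 x ^ 2}.Nonempty := by
    have hC : 0 ≤ ∑ i, ∑ j, ‖Φ i j‖ ^ 2 := by positivity
    refine ⟨1 + ∑ i, ∑ j, ‖Φ i j‖ ^ 2, by positivity, fun x _ => ⟨?_, ?_⟩⟩
    · nlinarith [sq_nonneg (l2 x), sq_nonneg (l2 (Φ.mulVec x)), mul_nonneg hC (sq_nonneg (l2 x))]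
    · nlinarith [sq_nonneg (l2 x), l2_mulVec_sq_le Φ x]
  refine le_csInf hne ?_
  rintro δ ⟨hδ, hΦ⟩
  refine csSup_le (Set.Nonempty.image _ ⟨0, by simp [l2]⟩) ?_
  rintro _ ⟨x, hx, rfl⟩
  rw [Set.mem_ofPred_eq] at hx
  dsimp only
  set u := ((colSub Φ S)ᴴ * colSub Φ T).mulVec x with hu
  have hin : (star ((colSub Φ S).mulVec u) ⬝ᵥ (colSub Φ T).mulVec x).re = l2 u ^ 2 := by
    rw [Matrix.star_mulVec, ← Matrix.dotProduct_mulVec, Matrix.mulVec_mulVec, ← hu,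
      star_dotProduct_self_re]
  have hpol := l2_add_sq_sub_l2_sub_sq ((colSub Φ S).mulVec u) ((colSub Φ T).mulVec x) (l2 u)
  have hmul (c : ℂ) : Φ.mulVec (extendZero S u + c • extendZero T x)
      = (colSub Φ S).mulVec u + c • (colSub Φ T).mulVec x := by
    rw [Matrix.mulVec_add, Matrix.mulVec_smul, mulVec_extendZero, mulVec_extendZero]
  have hup := (hΦ _ (sparse_extendZero_add hcard u x (l2 u : ℂ))).2
  have hlo := (hΦ _ (sparse_extendZero_add hcard u x ((-l2 u : ℝ) : ℂ))).1
  rw [hmul, l2_extendZero_add_sq hdisj, Complex.norm_real, Real.norm_eq_abs, sq_abs] at hup hlo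
  rw [neg_sq] at hlo
  rw [hin] at hpol
  have hx2 : l2 x ^ 2 ≤ 1 := pow_le_one₀ (l2_nonneg x) hx
  have hn := l2_nonneg u
  rcases hn.eq_or_lt with h0 | hpos
  · rwa [← h0]
  · have hbound : l2 u ^ 2 * l2 u ≤ l2 u ^ 2 * δ := by
      nlinarith [mul_le_mul_of_nonneg_left hx2 (mul_nonneg hδ (sq_nonneg (l2 u)))]
    exact le_of_mul_le_mul_left hbound (by positivity)
end

section
/- Let Φ be an m×N complex matrix, let r be a positive integer, and let δ ≥ 0. Suppose that ‖Φx‖₂ ≤ √(1+δ)·‖x‖₂ for every x ∈ ℂ^N with at most r nonzero entries. Then for every signal x ∈ ℂ^N, ‖Φx‖₂ ≤ √(1+δ)·(‖x‖₂ + r^{−1/2}·‖x‖₁). -/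
open Matrix
open scoped BigOperators Classical

theorem l2_eq_norm {ι : Type*} [Fintype ι] (x : ι → ℂ) : l2 x = ‖WithLp.toLp 2 x‖ := by
  simp [l2, EuclideanSpace.norm_eq]

theorem l2_add_le {ι : Type*} [Fintype ι] (x y : ι → ℂ) : l2 (x + y) ≤ l2 x + l2 y := by
  simpa only [l2_eq_norm, WithLp.toLp_add] using norm_add_le (WithLp.toLp 2 x) (WithLp.toLp 2 y)

theorem l2_restrictTo {N : ℕ} (x : Fin N → ℂ) (T : Finset (Fin N)) :
    l2 (restrictTo x T) = Real.sqrt (∑ i ∈ T, ‖x i‖ ^ 2) := by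
  have h (i : Fin N) : ‖restrictTo x T i‖ ^ 2 = if i ∈ T then ‖x i‖ ^ 2 else 0 := by
    unfold restrictTo
    split_ifs <;> simp
  simp [l2, h]

theorem restrictTo_univ {N : ℕ} (x : Fin N → ℂ) : restrictTo x Finset.univ = x := by
  ext i
  simp [restrictTo]

theorem restrictTo_add_restrictTo_sdiff {N : ℕ} (x : Fin N → ℂ) {S T : Finset (Fin N)}
    (hTS : T ⊆ S) : restrictTo x T + restrictTo x (S \ T) = restrictTo x S := by
  ext i
  by_cases hT : i ∈ T
  · simp [restrictTo, hT, hTS hT]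
  · simp [restrictTo, hT]

theorem sparse_restrictTo {N r : ℕ} (x : Fin N → ℂ) {T : Finset (Fin N)} (hT : T.card ≤ r) :
    Sparse r (restrictTo x T) := by
  refine (Finset.card_le_card fun i hi => ?_).trans hT
  by_contra h
  simp [suppF, restrictTo, h] at hi

/-- Every finite set contains a subset of prescribed size on which `f` is largest. -/
theorem exists_subset_card_eq_forall_le {α β : Type*} [DecidableEq α] [LinearOrder β] (f : α → β)
    (S : Finset α) {r : ℕ} (hr : r ≤ S.card) :
    ∃ T ⊆ S, T.card = r ∧ ∀ i ∈ T, ∀ j ∈ S \ T, f j ≤ f i := by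
  induction r with
  | zero => exact ⟨∅, by simp⟩
  | succ r ih =>
    obtain ⟨T, hTS, hcard, htop⟩ := ih (by lia)
    have hne : (S \ T).Nonempty := by
      rw [← Finset.card_pos, Finset.card_sdiff_of_subset hTS]
      lia
    obtain ⟨a, ha, hmax⟩ := Finset.exists_max_image (S \ T) f hne
    have ha' := Finset.mem_sdiff.1 ha
    refine ⟨insert a T, Finset.insert_subset ha'.1 hTS, by simp [ha'.2, hcard], ?_⟩
    intro i hi j hj
    have hj' : j ∈ S \ T :=
      Finset.sdiff_subset_sdiff subset_rfl (Finset.subset_insert a T) hj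
    rcases Finset.mem_insert.1 hi with rfl | hi
    · exact hmax j hj'
    · exact htop i hi j hj'

/-- If the values of `f` on `T` dominate those on `U`, where `U` has at most as many elements as
`T`, then the `ℓ₂` norm over `U` is controlled by the `ℓ₁` norm over `T`. -/
theorem sqrt_sum_sq_le_of_forall_le {α : Type*} {f : α → ℝ} (hf : ∀ i, 0 ≤ f i)
    {T U : Finset α} (hT : 0 < T.card) (hcard : U.card ≤ T.card)
    (h : ∀ i ∈ T, ∀ j ∈ U, f j ≤ f i) :
    Real.sqrt (∑ j ∈ U, f j ^ 2) ≤ (Real.sqrt T.card)⁻¹ * ∑ i ∈ T, f i := by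
  have hr : (0 : ℝ) < T.card := by exact_mod_cast hT
  have hs : 0 ≤ ∑ i ∈ T, f i := Finset.sum_nonneg fun i _ => hf i
  have hle (j : α) (hj : j ∈ U) : f j ≤ (∑ i ∈ T, f i) / T.card := by
    rw [le_div_iff₀' hr, ← nsmul_eq_mul]
    exact Finset.card_nsmul_le_sum T f _ fun i hi => h i hi j hj
  refine Real.sqrt_le_iff.2 ⟨by positivity, ?_⟩
  calc ∑ j ∈ U, f j ^ 2 ≤ U.card • ((∑ i ∈ T, f i) / T.card) ^ 2 :=
        Finset.sum_le_card_nsmul _ _ _ fun j hj => pow_le_pow_left₀ (hf j) (hle j hj) 2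
    _ ≤ T.card * ((∑ i ∈ T, f i) / T.card) ^ 2 := by
        rw [nsmul_eq_mul]
        gcongr
    _ = ((Real.sqrt T.card)⁻¹ * ∑ i ∈ T, f i) ^ 2 := by
        rw [mul_pow, inv_pow, Real.sq_sqrt hr.le]
        field_simp

theorem exists_l2_mulVec_restrictTo_le {m N : ℕ} (Φ : Matrix (Fin m) (Fin N) ℂ) {r : ℕ}
    (hr : 0 < r) {C : ℝ} (hC : 0 ≤ C)
    (hΦ : ∀ x : Fin N → ℂ, Sparse r x → l2 (Φ.mulVec x) ≤ C * l2 x)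
    (x : Fin N → ℂ) (S : Finset (Fin N)) :
    ∃ T ⊆ S, T.card ≤ r ∧ l2 (Φ.mulVec (restrictTo x S)) ≤
      C * (l2 (restrictTo x T) + (Real.sqrt r)⁻¹ * ∑ i ∈ S, ‖x i‖) := by
  induction S using Finset.strongInduction with
  | H S ih =>
    rcases le_or_gt S.card r with hS | hS
    · refine ⟨S, subset_rfl, hS, (hΦ _ (sparse_restrictTo x hS)).trans ?_⟩
      gcongr
      exact le_add_of_nonneg_right (by positivity)
    · obtain ⟨T, hTS, hT, htop⟩ := exists_subset_card_eq_forall_le (fun i => ‖x i‖) S hS.le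
      obtain ⟨U, hUS, hU, hbound⟩ :=
        ih (S \ T) (Finset.sdiff_ssubset hTS (Finset.card_pos.1 (hT ▸ hr)))
      refine ⟨T, hTS, hT.le, ?_⟩
      have htail : l2 (restrictTo x U) ≤ (Real.sqrt r)⁻¹ * ∑ i ∈ T, ‖x i‖ := by
        rw [l2_restrictTo, ← hT]
        exact sqrt_sum_sq_le_of_forall_le (fun i => norm_nonneg (x i)) (hT ▸ hr) (hT ▸ hU)
          fun i hi j hj => htop i hi j (hUS hj)
      calc l2 (Φ.mulVec (restrictTo x S))
          ≤ l2 (Φ.mulVec (restrictTo x T)) + l2 (Φ.mulVec (restrictTo x (S \ T))) := by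
            rw [← restrictTo_add_restrictTo_sdiff x hTS, Matrix.mulVec_add]
            exact l2_add_le _ _
        _ ≤ C * l2 (restrictTo x T) + C * ((Real.sqrt r)⁻¹ * ∑ i ∈ T, ‖x i‖ +
              (Real.sqrt r)⁻¹ * ∑ i ∈ S \ T, ‖x i‖) := by
            refine add_le_add (hΦ _ (sparse_restrictTo x hT.le)) (hbound.trans ?_)
            gcongr
        _ = C * (l2 (restrictTo x T) + (Real.sqrt r)⁻¹ * ∑ i ∈ S, ‖x i‖) := by
            rw [← Finset.sum_sdiff hTS]
            ring

/-- **Energy bound.**  If `‖Φx‖₂ ≤ √(1+δ)‖x‖₂` for all `r`-sparse `x`, then for every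
signal `x`, `‖Φx‖₂ ≤ √(1+δ)(‖x‖₂ + r^{-1/2}‖x‖₁)`. -/
theorem energy_bound
    {m N : ℕ} (Φ : Matrix (Fin m) (Fin N) ℂ) (r : ℕ) (hr : 0 < r)
    (δ : ℝ) (hδ : 0 ≤ δ)
    (hupper : ∀ x : Fin N → ℂ, Sparse r x →
      l2 (Φ.mulVec x) ≤ Real.sqrt (1 + δ) * l2 x) :
    ∀ x : Fin N → ℂ,
      l2 (Φ.mulVec x) ≤ Real.sqrt (1 + δ) * (l2 x + (Real.sqrt r)⁻¹ * l1 x) := by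
  intro x
  obtain ⟨T, -, -, hT⟩ :=
    exists_l2_mulVec_restrictTo_le Φ hr (Real.sqrt_nonneg (1 + δ)) hupper x Finset.univ
  rw [restrictTo_univ] at hT
  refine hT.trans ?_
  rw [l1, l2_restrictTo, l2]
  gcongr
  exact Finset.subset_univ T
end
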